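/- Let 0 < f < 1, N > 0, K ≥ 2N a natural number. With p as above (p(0) = 1 − (N/K)(1 − f^K), p(n) = (N/K)C(K,n)(1−f)^n f^{K−n} for 1 ≤ n ≤ K), the Shannon entropy satisfies H(p) ≤ 2√(N/K) + √((N/K)·(π/2)·e·N·f·(1−f)). -/

import Mathlib

/-- Fock-basis diagonal of the channel output for the input state
`√(1−N/K)|0⟩ + √(N/K)|K⟩`. -/
noncomputable def pOut (f N : ℝ) (K n : ℕ) : ℝ :=
  if n = 0 then 1 - (N / K) * (1 - f ^ K)
  else (N / K) * (K.choose n) * (1 - f) ^ n * f ^ (K - n)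

lemma aux_gibbs (s : Finset ℕ) (b g : ℕ → ℝ) (Z : ℝ) (hZ : 0 < Z) (hb : ∀ n ∈ s, 0 < b n)
    (hb1 : ∑ n ∈ s, b n = 1) (hg : ∑ n ∈ s, Real.exp (-g n) ≤ Z) :
    ∑ n ∈ s, Real.negMulLog (b n) ≤ ∑ n ∈ s, b n * g n + Real.log Z := by
  have key : ∀ n ∈ s, Real.negMulLog (b n) ≤
      b n * g n + b n * Real.log Z + (Real.exp (-g n) / Z - b n) := by
    intro n hn
    have h := hb n hn
    have h1 := Real.log_le_sub_one_of_pos (x := Real.exp (-g n) / (Z * b n)) (by positivity)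
    rw [Real.log_div (by positivity) (by positivity), Real.log_exp,
      Real.log_mul hZ.ne' h.ne'] at h1
    have h2 := mul_le_mul_of_nonneg_left h1 h.le
    have h3 : b n * (Real.exp (-g n) / (Z * b n) - 1) = Real.exp (-g n) / Z - b n := by
      field_simp
    rw [h3] at h2
    unfold Real.negMulLog
    nlinarith
  have h := Finset.sum_le_sum key
  rw [Finset.sum_add_distrib, Finset.sum_add_distrib, Finset.sum_sub_distrib, ← Finset.sum_mul,
    ← Finset.sum_div, hb1] at h
  have : (∑ n ∈ s, Real.exp (-g n)) / Z ≤ 1 := (div_le_one hZ).2 hg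
  linarith

lemma aux_geo (a : ℝ) (h0 : 0 ≤ a) (h1 : a < 1) (n : ℕ) :
    ∑ k ∈ Finset.range n, a ^ k ≤ 1 / (1 - a) := by
  rw [one_div]
  exact (summable_geometric_of_lt_one h0 h1).sum_le_tsum _ (fun i _ => by positivity) |>.trans
    (tsum_geometric_of_lt_one h0 h1).le

lemma aux_sum (G : ℕ → ℝ) (j K : ℕ) (A B a b : ℝ) (hG : ∀ n, 0 ≤ G n) (hA : 0 ≤ A) (hB : 0 ≤ B)
    (ha : 0 ≤ a) (ha1 : a < 1) (hb : 0 ≤ b) (hb1 : b < 1)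
    (h1 : ∀ k ≤ j, G (j - k) ≤ A * a ^ k) (h2 : ∀ k, G (j + 1 + k) ≤ B * b ^ k) :
    ∑ n ∈ Finset.range (K + 1), G n ≤ A * (1 / (1 - a)) + B * (1 / (1 - b)) := by
  calc ∑ n ∈ Finset.range (K + 1), G n ≤ ∑ n ∈ Finset.range (j + 1 + (K + 1)), G n := by
        apply Finset.sum_le_sum_of_subset_of_nonneg
        · intro x hx
          simp only [Finset.mem_range] at *
          omega
        · intros; exact hG _
    _ = ∑ k ∈ Finset.range (j + 1), G (j - k) + ∑ k ∈ Finset.range (K + 1), G (j + 1 + k) := by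
        rw [Finset.sum_range_add]
        congr 1
        rw [← Finset.sum_range_reflect]
        simp
    _ ≤ ∑ k ∈ Finset.range (j + 1), A * a ^ k + ∑ k ∈ Finset.range (K + 1), B * b ^ k := by
        apply add_le_add
        · apply Finset.sum_le_sum
          intro k hk
          exact h1 k (by simp only [Finset.mem_range] at hk; omega)
        · exact Finset.sum_le_sum fun k _ => h2 k
    _ ≤ _ := by
        rw [← Finset.mul_sum, ← Finset.mul_sum]
        exact add_le_add (mul_le_mul_of_nonneg_left (aux_geo a ha ha1 _) hA)
          (mul_le_mul_of_nonneg_left (aux_geo b hb hb1 _) hB)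

lemma aux_lin (m : ℝ) (hm : 0 ≤ m) (K : ℕ) :
    ∑ n ∈ Finset.range (K + 1), Real.exp (-(Real.log 3 * |(n : ℝ) - m|)) ≤ 2 := by
  set j := ⌊m⌋₊ with hj
  have hj1 : (j : ℝ) ≤ m := Nat.floor_le hm
  have hj2 : m < j + 1 := Nat.lt_floor_add_one m
  have hl : 0 < Real.log 3 := Real.log_pos (by norm_num)
  set t := m - j with ht
  have e3 : Real.exp (-Real.log 3) = 1 / 3 := by
    rw [Real.exp_neg, Real.exp_log (by norm_num)]; norm_num
  have h := aux_sum (fun n => Real.exp (-(Real.log 3 * |(n : ℝ) - m|))) j K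
    (Real.exp (-(Real.log 3 * t))) (Real.exp (-(Real.log 3 * (1 - t)))) (1/3) (1/3)
    (fun n => (Real.exp_pos _).le) (Real.exp_pos _).le (Real.exp_pos _).le (by norm_num)
    (by norm_num) (by norm_num) (by norm_num)
    (by
      intro k hk
      rw [← e3, ← Real.exp_nat_mul, ← Real.exp_add]
      apply Real.exp_le_exp.2
      push_cast [hk]
      have : (k + t) ≤ |(j : ℝ) - k - m| := by
        rw [abs_sub_comm]
        refine le_trans (le_of_eq ?_) (le_abs_self _)
        rw [ht]; ring
      nlinarith)
    (by
      intro k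
      rw [← e3, ← Real.exp_nat_mul, ← Real.exp_add]
      apply Real.exp_le_exp.2
      push_cast
      have : (k + (1 - t)) ≤ |(j : ℝ) + 1 + k - m| := by
        refine le_trans (le_of_eq ?_) (le_abs_self _)
        rw [ht]; ring
      nlinarith)
  refine h.trans ?_
  have hx : Real.exp (-(Real.log 3 * t)) ≤ 1 := by
    apply Real.exp_le_one_iff.2
    have : 0 ≤ t := by linarith
    nlinarith
  have hy : Real.exp (-(Real.log 3 * (1 - t))) ≤ 1 := by
    apply Real.exp_le_one_iff.2
    have : 0 ≤ 1 - t := by linarith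
    nlinarith
  have hxy : Real.exp (-(Real.log 3 * t)) * Real.exp (-(Real.log 3 * (1 - t))) = 1 / 3 := by
    rw [← Real.exp_add, ← e3]; congr 1; ring
  nlinarith

lemma aux_half (t : ℝ) :
    Real.exp (-(2 * t ^ 2)) + Real.exp (-(2 * (1 - t) ^ 2)) ≤ 2 * Real.exp (-(1 / 2)) := by
  have h := Real.cosh_le_exp_half_sq (2 * t - 1)
  rw [Real.cosh_eq] at h
  have h1 : Real.exp (-(2 * t ^ 2)) =
      Real.exp (-(1/2) - (2 * t - 1) ^ 2 / 2) * Real.exp (-(2 * t - 1)) := by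
    rw [← Real.exp_add]; congr 1; ring
  have h2 : Real.exp (-(2 * (1 - t) ^ 2)) =
      Real.exp (-(1/2) - (2 * t - 1) ^ 2 / 2) * Real.exp (2 * t - 1) := by
    rw [← Real.exp_add]; congr 1; ring
  have h3 : Real.exp (-(1/2)) =
      Real.exp (-(1/2) - (2 * t - 1) ^ 2 / 2) * Real.exp ((2 * t - 1) ^ 2 / 2) := by
    rw [← Real.exp_add]; congr 1; ring
  rw [h1, h2, h3]
  have := Real.exp_pos (-(1/2) - (2 * t - 1) ^ 2 / 2)
  nlinarith

lemma aux_em2 : Real.exp (-2) ≤ 0.1354 := by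
  have h : Real.exp (-2) = Real.exp (-1) ^ 2 := by rw [← Real.exp_nat_mul]; norm_num
  rw [h]
  have := Real.exp_neg_one_lt_d9
  have := Real.exp_pos (-1)
  nlinarith

lemma aux_emh : Real.exp (-(1/2)) ≤ 0.6066 := by
  have h : Real.exp (-1) = Real.exp (-(1/2)) ^ 2 := by rw [← Real.exp_nat_mul]; norm_num
  have := Real.exp_neg_one_lt_d9
  have hp := Real.exp_pos (-(1/2))
  by_contra hc
  push Not at hc
  rw [h] at this
  norm_num at this hc hp
  nlinarith

lemma aux_gauss (m : ℝ) (hm : 0 ≤ m) (K : ℕ) :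
    ∑ n ∈ Finset.range (K + 1), Real.exp (-(2 * ((n : ℝ) - m) ^ 2)) ≤ 11 / 8 := by
  set j := ⌊m⌋₊ with hj
  have hj1 : (j : ℝ) ≤ m := Nat.floor_le hm
  have hj2 : m < j + 1 := Nat.lt_floor_add_one m
  set t := m - j with ht
  have ht0 : 0 ≤ t := by linarith
  have ht1 : 0 ≤ 1 - t := by linarith
  have sq : ∀ k : ℕ, (k : ℝ) ≤ (k : ℝ) ^ 2 := by
    intro k; exact_mod_cast Nat.le_self_pow (by norm_num) k
  have hX : Real.exp (-(4 * t)) ≤ 1 := Real.exp_le_one_iff.2 (by linarith)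
  have hY : Real.exp (-(4 * (1 - t))) ≤ 1 := Real.exp_le_one_iff.2 (by linarith)
  have hX0 := Real.exp_pos (-(4 * t))
  have hY0 := Real.exp_pos (-(4 * (1 - t)))
  have hE0 := Real.exp_pos (-2)
  have hE := aux_em2
  have hXY : Real.exp (-(4 * t)) * Real.exp (-(4 * (1 - t))) = Real.exp (-2) ^ 2 := by
    rw [← Real.exp_add, ← Real.exp_nat_mul]; congr 1; push_cast; ring
  have haux := aux_half t
  have hA1 : Real.exp (-(2 * t ^ 2)) ≤ 1 := Real.exp_le_one_iff.2 (by nlinarith)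
  have hB1 : Real.exp (-(2 * (1 - t) ^ 2)) ≤ 1 := Real.exp_le_one_iff.2 (by nlinarith)
  have h := aux_sum (fun n => Real.exp (-(2 * ((n : ℝ) - m) ^ 2))) j K
    (Real.exp (-(2 * t ^ 2))) (Real.exp (-(2 * (1 - t) ^ 2)))
    (Real.exp (-2) * Real.exp (-(4 * t))) (Real.exp (-2) * Real.exp (-(4 * (1 - t))))
    (fun n => (Real.exp_pos _).le) (Real.exp_pos _).le (Real.exp_pos _).le (by positivity)
    (by nlinarith) (by positivity) (by nlinarith)
    (by
      intro k hk
      rw [← Real.exp_add, ← Real.exp_nat_mul, ← Real.exp_add]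
      apply Real.exp_le_exp.2
      push_cast [hk]
      have : (j : ℝ) - k - m = - (k + t) := by rw [ht]; ring
      rw [this]
      nlinarith [sq k])
    (by
      intro k
      rw [← Real.exp_add, ← Real.exp_nat_mul, ← Real.exp_add]
      apply Real.exp_le_exp.2
      push_cast
      have : (j : ℝ) + 1 + k - m = k + (1 - t) := by rw [ht]; ring
      rw [this]
      nlinarith [sq k])
  refine h.trans ?_
  have step : ∀ A X : ℝ, 0 ≤ A → A ≤ 1 → 0 < X → X ≤ 1 →
      A * (1 / (1 - Real.exp (-2) * X)) ≤ A + 0.1567 * X := by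
    intro A X hA hA1 hX hX1
    have hpos : 0 < 1 - Real.exp (-2) * X := by nlinarith
    have hle : Real.exp (-2) * X ≤ 0.1354 := by nlinarith
    rw [mul_one_div, div_le_iff₀ hpos]
    have e1 : A * (Real.exp (-2) * X) ≤ 1 * (Real.exp (-2) * X) :=
      mul_le_mul_of_nonneg_right hA1 (by positivity)
    have e2 : X * Real.exp (-2) ≤ X * 0.1354 := mul_le_mul_of_nonneg_left hE hX.le
    have e3 : X * (Real.exp (-2) * X) ≤ X * 0.1354 := mul_le_mul_of_nonneg_left hle hX.le
    nlinarith
  have s1 := step _ _ (Real.exp_pos (-(2 * t ^ 2))).le hA1 hX0 hX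
  have s2 := step _ _ (Real.exp_pos (-(2 * (1 - t) ^ 2))).le hB1 hY0 hY
  have s3 : Real.exp (-(4 * t)) + Real.exp (-(4 * (1 - t))) ≤ 1 + 0.1354 ^ 2 := by
    nlinarith
  have := aux_emh
  linarith

lemma aux_log3 : Real.log 3 ≤ 1.0987 := by
  have h := Real.sum_le_exp_of_nonneg (x := 1.0987) (by norm_num) 10
  rw [Real.log_le_iff_le_exp (by norm_num)]
  refine le_trans ?_ h
  norm_num [Finset.sum_range_succ, Nat.factorial]

lemma aux_log74 : Real.log (7/4) ≤ 0.561 := by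
  have h := Real.sum_le_exp_of_nonneg (x := 0.561) (by norm_num) 7
  rw [Real.log_le_iff_le_exp (by norm_num)]
  refine le_trans ?_ h
  norm_num [Finset.sum_range_succ, Nat.factorial]

lemma aux_log118 : Real.log (11/8) ≤ 0.32 := by
  have h := Real.sum_le_exp_of_nonneg (x := 0.32) (by norm_num) 7
  rw [Real.log_le_iff_le_exp (by norm_num)]
  refine le_trans ?_ h
  norm_num [Finset.sum_range_succ, Nat.factorial]

/-- Entropy (in nats) of a law on `{0, …, K}` in terms of its standard deviation. -/
lemma aux_ent (b : ℕ → ℝ) (K : ℕ) (m V : ℝ) (hm : 0 ≤ m)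
    (hb : ∀ n ∈ Finset.range (K + 1), 0 < b n)
    (hb1 : ∑ n ∈ Finset.range (K + 1), b n = 1)
    (hV : ∑ n ∈ Finset.range (K + 1), b n * ((n : ℝ) - m) ^ 2 = V) :
    ∑ n ∈ Finset.range (K + 1), Real.negMulLog (b n) ≤ 0.45 + 1.43 * Real.sqrt V := by
  have hV0 : 0 ≤ V := by
    rw [← hV]
    exact Finset.sum_nonneg fun n hn => mul_nonneg (hb n hn).le (sq_nonneg _)
  have hw := Real.sqrt_nonneg V
  have hw2 := Real.sq_sqrt hV0
  set w := Real.sqrt V with hwdef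
  by_cases hc : w ≤ 0.78
  · have h := aux_gibbs (Finset.range (K + 1)) b (fun n => 2 * ((n : ℝ) - m) ^ 2) (11/8)
      (by norm_num) hb hb1 (aux_gauss m hm K)
    have e : ∑ n ∈ Finset.range (K + 1), b n * (2 * ((n : ℝ) - m) ^ 2) = 2 * V := by
      rw [← hV, Finset.mul_sum]
      exact Finset.sum_congr rfl fun n _ => by ring
    rw [e] at h
    have := aux_log118
    nlinarith
  · push Not at hc
    have h := aux_gibbs (Finset.range (K + 1)) b (fun n => Real.log 3 * |(n : ℝ) - m|) 2
      (by norm_num) hb hb1 (aux_lin m hm K)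
    have e : ∑ n ∈ Finset.range (K + 1), b n * (Real.log 3 * |(n : ℝ) - m|)
        = Real.log 3 * ∑ n ∈ Finset.range (K + 1), b n * |(n : ℝ) - m| := by
      rw [Finset.mul_sum]
      exact Finset.sum_congr rfl fun n _ => by ring
    have cs : ∑ n ∈ Finset.range (K + 1), b n * |(n : ℝ) - m| ≤ w := by
      have : ∀ n ∈ Finset.range (K + 1), b n * |(n : ℝ) - m| ≤
          b n * (w / 2) + b n * ((n : ℝ) - m) ^ 2 / (2 * w) := by
        intro n hn
        have hbn := hb n hn
        have hwp : 0 < w := by linarith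
        have : |(n : ℝ) - m| ≤ w / 2 + ((n : ℝ) - m) ^ 2 / (2 * w) := by
          rw [← sq_abs]
          rw [div_add_div _ _ (by norm_num) (by positivity), le_div_iff₀ (by positivity)]
          nlinarith [sq_nonneg (w - |(n : ℝ) - m|)]
        calc _ ≤ b n * (w / 2 + ((n : ℝ) - m) ^ 2 / (2 * w)) :=
              mul_le_mul_of_nonneg_left this hbn.le
          _ = _ := by ring
      have h2 := Finset.sum_le_sum this
      rw [Finset.sum_add_distrib, ← Finset.sum_mul, ← Finset.sum_div, hb1, hV, ← hw2] at h2
      refine h2.trans (le_of_eq ?_)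
      have hwp : w ≠ 0 := by linarith
      field_simp
      ring
    rw [e] at h
    have h3 := aux_log3
    have h30 : 0 < Real.log 3 := Real.log_pos (by norm_num)
    have := Real.log_two_lt_d9
    have : Real.log 3 * ∑ n ∈ Finset.range (K + 1), b n * |(n : ℝ) - m| ≤ Real.log 3 * w :=
      mul_le_mul_of_nonneg_left cs h30.le
    have : Real.log 3 * w ≤ 1.0987 * w := mul_le_mul_of_nonneg_right h3 hw
    norm_num at *
    linarith

lemma aux_neg (z : ℝ) (h0 : 0 < z) (h1 : z ≤ 1) : Real.negMulLog z ≤ (1 - z ^ 2) / 2 := by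
  have hs : 0 ≤ -Real.log z := by linarith [Real.log_nonpos h0.le h1]
  have h := Real.self_le_sinh_iff.2 hs
  rw [Real.sinh_eq, neg_neg, Real.exp_neg, Real.exp_log h0] at h
  have h2 := mul_le_mul_of_nonneg_left h h0.le
  have h3 : z * ((z⁻¹ - z) / 2) = (1 - z ^ 2) / 2 := by field_simp
  rw [h3] at h2
  unfold Real.negMulLog
  linarith

lemma aux_bin (q : ℝ) (h0 : 0 < q) (h1 : q ≤ 1 / 2) :
    Real.negMulLog q + Real.negMulLog (1 - q) + 0.45 * q ≤ 2 * Real.log 2 * Real.sqrt q := by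
  have hn := aux_neg (1 - q) (by linarith) (by linarith)
  have hx : 0 < Real.sqrt q := Real.sqrt_pos.2 h0
  have hq : q = Real.sqrt q ^ 2 := (Real.sq_sqrt h0.le).symm
  set x := Real.sqrt q with hxdef
  have ht := Real.log_le_sub_one_of_pos (x := x⁻¹ / (7 / 4)) (by positivity)
  rw [Real.log_div (by positivity) (by norm_num), Real.log_inv] at ht
  have hl : Real.log q = 2 * Real.log x := by rw [hq, Real.log_pow]; norm_num
  have h74 := aux_log74
  have h2 := Real.log_two_gt_d9
  have e1 : -Real.log x ≤ 0.561 - 1 + x⁻¹ * (4 / 7) := by linarith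
  have e2 : Real.negMulLog q ≤ 2 * x ^ 2 * (0.561 - 1) + 8 / 7 * x := by
    have : Real.negMulLog q = 2 * x ^ 2 * (-Real.log x) := by
      unfold Real.negMulLog; rw [hl, hq]; ring
    rw [this]
    refine (mul_le_mul_of_nonneg_left e1 (by positivity)).trans (le_of_eq ?_)
    field_simp
    ring
  have e3 : (1 - (1 - q) ^ 2) / 2 = x ^ 2 - x ^ 4 / 2 := by rw [hq]; ring
  rw [e3] at hn
  have hc : 0 ≤ 0.2434 - 0.572 * x + x ^ 3 / 2 := by
    nlinarith [mul_nonneg (sq_nonneg (x - 0.6175)) (by linarith : 0 ≤ x + 1.235)]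
  have hc2 := mul_nonneg hx.le hc
  have h5 : 0.6931471803 * x ≤ Real.log 2 * x := mul_le_mul_of_nonneg_right h2.le hx.le
  have h6 : 0.45 * q = 0.45 * x ^ 2 := by rw [← hq]
  nlinarith

lemma aux_subadd (a b : ℝ) (ha : 0 < a) (hb : 0 < b) :
    Real.negMulLog (a + b) ≤ Real.negMulLog a + Real.negMulLog b := by
  have h1 := Real.log_le_log ha (by linarith : a ≤ a + b)
  have h2 := Real.log_le_log hb (by linarith : b ≤ a + b)
  unfold Real.negMulLog
  nlinarith

lemma aux_const : 1.43 ≤ Real.log 2 * Real.sqrt (Real.pi / 2 * Real.exp 1) := by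
  have h2 := Real.log_two_gt_d9
  have hs : 2.066 ≤ Real.sqrt (Real.pi / 2 * Real.exp 1) := by
    apply Real.le_sqrt_of_sq_le
    have := Real.pi_gt_d4
    have := Real.exp_one_gt_d9
    norm_num at *
    nlinarith
  norm_num at *
  nlinarith

theorem stmt_4 (f N : ℝ) (hf0 : 0 < f) (hf1 : f < 1) (hN : 0 < N)
    (K : ℕ) (hK : 2 * N ≤ K) :
    -∑ n ∈ Finset.range (K + 1), pOut f N K n * Real.logb 2 (pOut f N K n) ≤
      2 * Real.sqrt (N / K) +
        Real.sqrt ((N / K) * (Real.pi / 2) * Real.exp 1 * N * f * (1 - f)) := by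
  have hK0 : (0 : ℝ) < K := by linarith
  set q := N / (K : ℝ) with hq
  have hq0 : 0 < q := by positivity
  have hq1 : q ≤ 1 / 2 := by rw [hq, div_le_iff₀ hK0]; linarith
  have hNq : N = q * K := by rw [hq]; field_simp
  have hf : 0 < 1 - f := by linarith
  set b : ℕ → ℝ := fun n => (K.choose n : ℝ) * (1 - f) ^ n * f ^ (K - n) with hbdef
  have hb : ∀ n ∈ Finset.range (K + 1), 0 < b n := by
    intro n hn
    have : 0 < K.choose n := Nat.choose_pos (by simp only [Finset.mem_range] at hn; omega)
    have : (0 : ℝ) < K.choose n := by exact_mod_cast this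
    simp only [hbdef]
    positivity
  have hb1 : ∑ n ∈ Finset.range (K + 1), b n = 1 := by
    have h := add_pow (1 - f) f K
    rw [sub_add_cancel, one_pow] at h
    rw [h]
    exact Finset.sum_congr rfl fun n _ => by simp only [hbdef]; ring
  have hV : ∑ n ∈ Finset.range (K + 1), b n * ((n : ℝ) - K * (1 - f)) ^ 2
      = K * f * (1 - f) := by
    have h := congrArg (Polynomial.eval (1 - f)) (bernsteinPolynomial.variance ℝ K)
    simp only [bernsteinPolynomial, Polynomial.eval_finsetSum, nsmul_eq_mul] at h
    simp at h
    have h' : (K : ℝ) * f * (1 - f) = K * (1 - f) * f := by ring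
    rw [h', ← h]
    exact Finset.sum_congr rfl fun n _ => by simp only [hbdef]; ring
  have hent := aux_ent b K (K * (1 - f)) (K * f * (1 - f)) (by positivity) hb hb1 hV
  have hbin := aux_bin q hq0 hq1
  have hp0 : pOut f N K 0 = (1 - q) + q * b 0 := by
    simp [pOut, hbdef, ← hq]; ring
  have hpn : ∀ n, pOut f N K (n + 1) = q * b (n + 1) := by
    intro n; simp [pOut, hbdef, ← hq]; ring
  have hb0 := hb 0 (by simp)
  have hmul : ∑ n ∈ Finset.range (K + 1), Real.negMulLog (q * b n)
      = Real.negMulLog q + q * ∑ n ∈ Finset.range (K + 1), Real.negMulLog (b n) := by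
    simp_rw [Real.negMulLog_mul]
    rw [Finset.sum_add_distrib, ← Finset.sum_mul, hb1, one_mul, Finset.mul_sum]
  have hH : ∑ n ∈ Finset.range (K + 1), Real.negMulLog (pOut f N K n) ≤
      Real.negMulLog (1 - q) + Real.negMulLog q
        + q * ∑ n ∈ Finset.range (K + 1), Real.negMulLog (b n) := by
    rw [add_assoc, ← hmul, Finset.sum_range_succ', Finset.sum_range_succ', hp0]
    simp_rw [hpn]
    have := aux_subadd (1 - q) (q * b 0) (by linarith) (by positivity)
    linarith
  have hl2 : 0 < Real.log 2 := Real.log_pos (by norm_num)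
  have hlhs : -∑ n ∈ Finset.range (K + 1), pOut f N K n * Real.logb 2 (pOut f N K n)
      = (∑ n ∈ Finset.range (K + 1), Real.negMulLog (pOut f N K n)) / Real.log 2 := by
    rw [← Finset.sum_neg_distrib, Finset.sum_div]
    refine Finset.sum_congr rfl fun n _ => ?_
    unfold Real.negMulLog Real.logb
    ring
  have hrhs : Real.sqrt (q * (Real.pi / 2) * Real.exp 1 * N * f * (1 - f))
      = q * (Real.sqrt (Real.pi / 2 * Real.exp 1) * Real.sqrt (K * f * (1 - f))) := by
    rw [← Real.sqrt_mul (by positivity)]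
    have e : q * (Real.pi / 2) * Real.exp 1 * N * f * (1 - f)
        = q ^ 2 * (Real.pi / 2 * Real.exp 1 * (K * f * (1 - f))) := by
      rw [hNq]; ring
    rw [e, Real.sqrt_mul (by positivity), Real.sqrt_sq hq0.le]
  rw [hlhs, hrhs, div_le_iff₀ hl2]
  have hw := Real.sqrt_nonneg (K * f * (1 - f))
  have h1 := mul_le_mul_of_nonneg_left hent hq0.le
  have h2 := mul_le_mul_of_nonneg_left (mul_le_mul_of_nonneg_right aux_const hw) hq0.le
  linarith
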